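/- Let (S, ∧, ⊔, ¬, 0, 1) be an orthocomplemented bisemilattice that additionally satisfies both distributivity laws x ⊔ (y ∧ z) = (x ⊔ y) ∧ (x ⊔ z) and x ∧ (y ⊔ z) = (x ∧ y) ⊔ (x ∧ z). Then S, with meet ∧, join ⊔, complement ¬, bottom 0 and top 1, is a Boolean algebra (i.e., these operations satisfy all axioms of a Boolean algebra). -/

import Mathlib

/-- An orthocomplemented bisemilattice satisfying both
distributivity laws is a Boolean algebra: there is a Mathlib `BooleanAlgebra`
structure on `S` whose inf, sup, complement, bot and top are the given
operations. -/
theorem ocbsl_distrib_is_boolean_algebra {S : Type*}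
    (m j : S → S → S) (neg : S → S) (z o : S)
    (hmcomm : ∀ x y, m x y = m y x)
    (hmassoc : ∀ x y z, m x (m y z) = m (m x y) z)
    (hmidem : ∀ x, m x x = x)
    (hjcomm : ∀ x y, j x y = j y x)
    (hjassoc : ∀ x y z, j x (j y z) = j (j x y) z)
    (hjidem : ∀ x, j x x = x)
    (hjone : ∀ x, j x o = o)
    (hmzero : ∀ x, m x z = z)
    (hjzero : ∀ x, j x z = x)
    (hmone : ∀ x, m x o = x)
    (hdneg : ∀ x, neg (neg x) = x)
    (hjcompl : ∀ x, j x (neg x) = o)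
    (hmcompl : ∀ x, m x (neg x) = z)
    (hdmj : ∀ x y, neg (j x y) = m (neg x) (neg y))
    (hdmm : ∀ x y, neg (m x y) = j (neg x) (neg y))
    (hdistjm : ∀ x y w, j x (m y w) = m (j x y) (j x w))
    (hdistmj : ∀ x y w, m x (j y w) = j (m x y) (m x w)) :
    ∃ B : BooleanAlgebra S,
      B.inf = m ∧ B.sup = j ∧ B.compl = neg ∧ B.bot = z ∧ B.top = o := by
  have absorb : ∀ x y, j x (m x y) = x := fun x y => by
    calc j x (m x y) = j (m x o) (m x y) := by rw [hmone]
      _ = m x (j y o) := by rw [← hdistmj, hjcomm o y]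
      _ = x := by rw [hjone, hmone]
  refine ⟨{
    le := fun x y => j x y = y
    lt := fun x y => j x y = y ∧ ¬ j y x = x
    lt_iff_le_not_ge := fun _ _ => Iff.rfl
    le_refl := hjidem
    le_trans := fun x y w (hxy : j x y = y) (hyw : j y w = w) => by
      rw [← hyw, hjassoc, hxy]
    le_antisymm := fun x y (hxy : j x y = y) (hyx : j y x = x) => by
      rw [← hyx, hjcomm, hxy]
    sup := j
    inf := m
    compl := neg
    top := o
    bot := z
    sdiff := fun x y => m x (neg y)
    himp := fun x y => j y (neg x)
    le_sup_left := fun x y => by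
      rw [hjassoc, hjidem]
    le_sup_right := fun x y => by
      rw [hjcomm x y, hjassoc, hjidem]
    sup_le := fun x y w (hxw : j x w = w) (hyw : j y w = w) => by
      rw [← hjassoc, hyw, hxw]
    inf_le_left := fun x y => (hjcomm _ _).trans (absorb x y)
    inf_le_right := fun x y => by
      rw [hjcomm, hmcomm, absorb]
    le_inf := fun x y w (hxy : j x y = y) (hxw : j x w = w) => by
      rw [hdistjm, hxy, hxw]
    le_sup_inf := fun x y w => by
      change j (m (j x y) (j x w)) (j x (m y w)) = j x (m y w)
      rw [← hdistjm, hjidem]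
    inf_compl_le_bot := fun x => by
      change j (m x (neg x)) z = z
      rw [hmcompl, hjidem]
    top_le_sup_compl := fun x => by
      change j o (j x (neg x)) = j x (neg x)
      rw [hjcompl, hjidem]
    le_top := hjone
    bot_le := fun x => (hjcomm z x).trans (hjzero x)
    sdiff_eq := fun _ _ => rfl
    himp_eq := fun _ _ => rfl }, rfl, rfl, rfl, rfl, rfl⟩
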